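/- On the negative-energy region, the functions L′ᵅᵢ and Γⱼ = −Aᵅⱼ/√(−2mH_α) satisfy the mixed so(4) relations: at every point (q,p) with qʲ ≠ 0 and pⱼ ≠ 0 for all j and H_α(q,p) < 0, one has {L′ᵅᵢ, Γⱼ}_α = ε_{ijh}α²Γₕ for all i,j,h ∈ {1,2,3}; in particular {L′ᵅ₁, Γ₂}_α = α²Γ₃, {L′ᵅ₂, Γ₃}_α = α²Γ₁, {L′ᵅ₃, Γ₁}_α = α²Γ₂, and {L′ᵅᵢ, Γᵢ}_α = 0. Together with the relations among the L′ᵅᵢ and among the Γᵢ, this yields a Lie algebra isomorphic to so(4). -/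

import Mathlib

noncomputable section

/-- The conformable power helper `|x|^(α-1) * x`. -/
def confPow (α x : ℝ) : ℝ := |x| ^ (α - 1) * x

/-- Partial derivative of `f : (q,p) ↦ ℝ` with respect to the coordinate `qⁱ`. -/
def pdq (f : (Fin 3 → ℝ) → (Fin 3 → ℝ) → ℝ) (i : Fin 3) (q p : Fin 3 → ℝ) : ℝ :=
  deriv (fun t => f (Function.update q i t) p) (q i)

/-- Partial derivative of `f : (q,p) ↦ ℝ` with respect to the coordinate `pᵢ`. -/
def pdp (f : (Fin 3 → ℝ) → (Fin 3 → ℝ) → ℝ) (i : Fin 3) (q p : Fin 3 → ℝ) : ℝ :=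
  deriv (fun t => f q (Function.update p i t)) (p i)

/-- The conformable Poisson bracket
`{f,g}_α = Σᵢ α⁻² |pᵢ|^{1-α} |qⁱ|^{1-α} (∂f/∂pᵢ ∂g/∂qⁱ - ∂f/∂qⁱ ∂g/∂pᵢ)`. -/
def confPB (α : ℝ) (f g : (Fin 3 → ℝ) → (Fin 3 → ℝ) → ℝ) (q p : Fin 3 → ℝ) : ℝ :=
  ∑ i : Fin 3, (α ^ 2)⁻¹ * |p i| ^ (1 - α) * |q i| ^ (1 - α) *
    (pdp f i q p * pdq g i q p - pdq f i q p * pdp g i q p)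

/-- The conformable radius `r_α = √(Σᵢ (α|qⁱ|^{α-1}qⁱ)²)`. -/
def rConf (α : ℝ) (q : Fin 3 → ℝ) : ℝ :=
  Real.sqrt (∑ i : Fin 3, (α * confPow α (q i)) ^ 2)

/-- The conformable Kepler Hamiltonian
`H_α = Σᵢ (α|pᵢ|^{α-1}pᵢ)²/(2m) - k/r_α`. -/
def Hconf (α m k : ℝ) (q p : Fin 3 → ℝ) : ℝ :=
  (∑ i : Fin 3, (α * confPow α (p i)) ^ 2 / (2 * m)) - k / rConf α q

/-- The conformable angular momentum components (cyclic in the indices). -/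
def Lconf (α : ℝ) (i : Fin 3) (q p : Fin 3 → ℝ) : ℝ :=
  α ^ 2 * (confPow α (q (i + 1)) * confPow α (p (i + 2)) -
           confPow α (q (i + 2)) * confPow α (p (i + 1)))

/-- The conformable Laplace–Runge–Lenz vector components (cyclic in the indices). -/
def Aconf (α m k : ℝ) (i : Fin 3) (q p : Fin 3 → ℝ) : ℝ :=
  α * (confPow α (p (i + 1)) * Lconf α (i + 2) q p -
       confPow α (p (i + 2)) * Lconf α (i + 1) q p) -
  α * m * k / rConf α q * confPow α (q i)

/-- The scaled Laplace–Runge–Lenz vector on the negative-energy region: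
`Γᵢ = -Aᵅᵢ/√(-2mH_α)`. -/
def GammaNeg (α m k : ℝ) (i : Fin 3) (q p : Fin 3 → ℝ) : ℝ :=
  -Aconf α m k i q p / Real.sqrt (-(2 * m * Hconf α m k q p))

/-- The scaled Laplace–Runge–Lenz vector on the positive-energy region:
`Γ⁺ᵢ = -Aᵅᵢ/√(2mH_α)`. -/
def GammaPos (α m k : ℝ) (i : Fin 3) (q p : Fin 3 → ℝ) : ℝ :=
  -Aconf α m k i q p / Real.sqrt (2 * m * Hconf α m k q p)

/-- The Levi-Civita symbol `ε_{ijh} = (1/2)(i-j)(j-h)(h-i)`. -/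
def levicivita (i j h : Fin 3) : ℝ :=
  ((i.1 : ℝ) - (j.1 : ℝ)) * ((j.1 : ℝ) - (h.1 : ℝ)) * ((h.1 : ℝ) - (i.1 : ℝ)) / 2

/-- `|x|^(1-α)` inverts the factor `|x|^(α-1)`. -/
theorem abs_rpow_mul_abs_rpow (α : ℝ) {x : ℝ} (hx : x ≠ 0) :
    |x| ^ (1 - α) * |x| ^ (α - 1) = 1 := by
  rw [← Real.rpow_add (abs_pos.mpr hx)]
  simp

theorem confPow_ne_zero (α : ℝ) {x : ℝ} (hx : x ≠ 0) : confPow α x ≠ 0 :=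
  mul_ne_zero (Real.rpow_pos_of_pos (abs_pos.mpr hx) _).ne' hx

theorem hasDerivAt_confPow (α : ℝ) {x : ℝ} (hx : x ≠ 0) :
    HasDerivAt (confPow α) (α * |x| ^ (α - 1)) x := by
  have h := ((hasDerivAt_abs hx).rpow_const (p := α - 1)
    (Or.inl (abs_ne_zero.mpr hx))).mul (hasDerivAt_id x)
  have hs : (SignType.sign x : ℝ) * x = |x| := sign_mul_self x
  have hr : |x| ^ (α - 1 - 1) * |x| = |x| ^ (α - 1) := by
    rw [Real.rpow_sub_one (abs_ne_zero.mpr hx) (α - 1),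
      div_mul_cancel₀ _ (abs_ne_zero.mpr hx)]
  refine h.congr_deriv ?_
  simp only [id]
  linear_combination (α - 1) * |x| ^ (α - 1 - 1) * hs + (α - 1) * hr

theorem hasDerivAt_confPow_update (α : ℝ) {x : Fin 3 → ℝ} (hx : ∀ j, x j ≠ 0) (i j : Fin 3) :
    HasDerivAt (fun t => confPow α (Function.update x i t j))
      (if j = i then α * |x j| ^ (α - 1) else 0) (x i) := by
  split_ifs with h
  · subst h
    simpa using hasDerivAt_confPow α (hx j)
  · simpa [Function.update_of_ne h] using hasDerivAt_const (x i) (confPow α (x j))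

/-- `g` is differentiable in each coordinate at `(q, p)` and `{f, g}_α = v` there. -/
structure HasConfPB (α : ℝ) (f g : (Fin 3 → ℝ) → (Fin 3 → ℝ) → ℝ) (v : ℝ)
    (q p : Fin 3 → ℝ) : Prop where
  diff_q : ∀ i, DifferentiableAt ℝ (fun t => g (Function.update q i t) p) (q i)
  diff_p : ∀ i, DifferentiableAt ℝ (fun t => g q (Function.update p i t)) (p i)
  confPB_eq : confPB α f g q p = v

namespace HasConfPB

variable {α : ℝ} {f g g₁ g₂ : (Fin 3 → ℝ) → (Fin 3 → ℝ) → ℝ} {v v₁ v₂ : ℝ}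
  {q p : Fin 3 → ℝ}

theorem congr_value (h : HasConfPB α f g v₁ q p) (hv : v₁ = v₂) : HasConfPB α f g v₂ q p :=
  hv ▸ h

theorem const (c : ℝ) : HasConfPB α f (fun _ _ => c) 0 q p where
  diff_q _ := differentiableAt_const c
  diff_p _ := differentiableAt_const c
  confPB_eq := by simp [confPB, pdq, pdp]

theorem add (h₁ : HasConfPB α f g₁ v₁ q p) (h₂ : HasConfPB α f g₂ v₂ q p) :
    HasConfPB α f (fun q p => g₁ q p + g₂ q p) (v₁ + v₂) q p where
  diff_q i := (h₁.diff_q i).add (h₂.diff_q i)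
  diff_p i := (h₁.diff_p i).add (h₂.diff_p i)
  confPB_eq := by
    rw [← h₁.confPB_eq, ← h₂.confPB_eq]
    simp only [confPB, ← Finset.sum_add_distrib]
    refine Finset.sum_congr rfl fun i _ => ?_
    have hq : pdq (fun q p => g₁ q p + g₂ q p) i q p = pdq g₁ i q p + pdq g₂ i q p :=
      deriv_fun_add (h₁.diff_q i) (h₂.diff_q i)
    have hp : pdp (fun q p => g₁ q p + g₂ q p) i q p = pdp g₁ i q p + pdp g₂ i q p :=
      deriv_fun_add (h₁.diff_p i) (h₂.diff_p i)
    rw [hq, hp]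
    ring

theorem mul (h₁ : HasConfPB α f g₁ v₁ q p) (h₂ : HasConfPB α f g₂ v₂ q p) :
    HasConfPB α f (fun q p => g₁ q p * g₂ q p) (v₁ * g₂ q p + g₁ q p * v₂) q p where
  diff_q i := (h₁.diff_q i).mul (h₂.diff_q i)
  diff_p i := (h₁.diff_p i).mul (h₂.diff_p i)
  confPB_eq := by
    rw [← h₁.confPB_eq, ← h₂.confPB_eq]
    simp only [confPB, Finset.sum_mul, Finset.mul_sum, ← Finset.sum_add_distrib]
    refine Finset.sum_congr rfl fun i _ => ?_
    have hq : pdq (fun q p => g₁ q p * g₂ q p) i q p =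
        pdq g₁ i q p * g₂ q p + g₁ q p * pdq g₂ i q p := by
      simpa [pdq] using deriv_fun_mul (h₁.diff_q i) (h₂.diff_q i)
    have hp : pdp (fun q p => g₁ q p * g₂ q p) i q p =
        pdp g₁ i q p * g₂ q p + g₁ q p * pdp g₂ i q p := by
      simpa [pdp] using deriv_fun_mul (h₁.diff_p i) (h₂.diff_p i)
    rw [hq, hp]
    ring

theorem comp {φ : ℝ → ℝ} {φ' : ℝ} (hφ : HasDerivAt φ φ' (g q p))
    (h : HasConfPB α f g v q p) :
    HasConfPB α f (fun q p => φ (g q p)) (φ' * v) q p := by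
  have hq i : HasDerivAt (fun t => φ (g (Function.update q i t) p)) (φ' * pdq g i q p) (q i) :=
    HasDerivAt.comp (q i) (h₂ := φ) (by simpa using hφ) (h.diff_q i).hasDerivAt
  have hp i : HasDerivAt (fun t => φ (g q (Function.update p i t))) (φ' * pdp g i q p) (p i) :=
    HasDerivAt.comp (p i) (h₂ := φ) (by simpa using hφ) (h.diff_p i).hasDerivAt
  refine ⟨fun i => (hq i).differentiableAt, fun i => (hp i).differentiableAt, ?_⟩
  rw [← h.confPB_eq]
  simp only [confPB, Finset.mul_sum]
  refine Finset.sum_congr rfl fun i _ => ?_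
  have hq' : pdq (fun q p => φ (g q p)) i q p = φ' * pdq g i q p := (hq i).deriv
  have hp' : pdp (fun q p => φ (g q p)) i q p = φ' * pdp g i q p := (hp i).deriv
  rw [hq', hp']
  ring

theorem neg (h : HasConfPB α f g v q p) : HasConfPB α f (fun q p => -g q p) (-v) q p :=
  (h.comp (hasDerivAt_neg (g q p))).congr_value (by ring)

theorem sub (h₁ : HasConfPB α f g₁ v₁ q p) (h₂ : HasConfPB α f g₂ v₂ q p) :
    HasConfPB α f (fun q p => g₁ q p - g₂ q p) (v₁ - v₂) q p := by
  simpa only [sub_eq_add_neg] using h₁.add h₂.neg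

theorem const_mul (c : ℝ) (h : HasConfPB α f g v q p) :
    HasConfPB α f (fun q p => c * g q p) (c * v) q p :=
  ((const c).mul h).congr_value (by ring)

theorem pow_two (h : HasConfPB α f g v q p) :
    HasConfPB α f (fun q p => g q p ^ 2) (2 * g q p * v) q p := by
  simp only [sq]
  exact (h.mul h).congr_value (by ring)

theorem inv (h : HasConfPB α f g v q p) (hg : g q p ≠ 0) :
    HasConfPB α f (fun q p => (g q p)⁻¹) (-(g q p ^ 2)⁻¹ * v) q p :=
  h.comp (hasDerivAt_inv hg)

theorem sqrt (h : HasConfPB α f g v q p) (hg : g q p ≠ 0) :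
    HasConfPB α f (fun q p => Real.sqrt (g q p)) (1 / (2 * Real.sqrt (g q p)) * v) q p :=
  h.comp (Real.hasDerivAt_sqrt hg)

theorem confPow_q (hq : ∀ j, q j ≠ 0) (j : Fin 3) :
    HasConfPB α f (fun q _ => confPow α (q j))
      ((α ^ 2)⁻¹ * |p j| ^ (1 - α) * α * pdp f j q p) q p := by
  have hd i := hasDerivAt_confPow_update α hq i j
  refine ⟨fun i => (hd i).differentiableAt, fun i => differentiableAt_const _, ?_⟩
  have h1 i : pdq (fun q _ => confPow α (q j)) i q p =
    if j = i then α * |q j| ^ (α - 1) else 0 := (hd i).deriv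
  have h2 i : pdp (fun q _ => confPow α (q j)) i q p = 0 := deriv_const _ _
  simp only [confPB, h1, h2, mul_ite, mul_zero, sub_zero, Finset.sum_ite_eq, Finset.mem_univ,
    if_true]
  linear_combination (α ^ 2)⁻¹ * |p j| ^ (1 - α) * α * pdp f j q p *
    abs_rpow_mul_abs_rpow α (hq j)

theorem confPow_p (hp : ∀ j, p j ≠ 0) (j : Fin 3) :
    HasConfPB α f (fun _ p => confPow α (p j))
      (-((α ^ 2)⁻¹ * |q j| ^ (1 - α) * α * pdq f j q p)) q p := by
  have hd i := hasDerivAt_confPow_update α hp i j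
  refine ⟨fun i => differentiableAt_const _, fun i => (hd i).differentiableAt, ?_⟩
  have h1 i : pdp (fun _ p => confPow α (p j)) i q p =
    if j = i then α * |p j| ^ (α - 1) else 0 := (hd i).deriv
  have h2 i : pdq (fun _ p => confPow α (p j)) i q p = 0 := deriv_const _ _
  simp only [confPB, h1, h2, mul_ite, mul_zero, zero_sub, mul_neg, Finset.sum_neg_distrib,
    Finset.sum_ite_eq, Finset.mem_univ, if_true]
  linear_combination -(α ^ 2)⁻¹ * |q j| ^ (1 - α) * α * pdq f j q p *
    abs_rpow_mul_abs_rpow α (hp j)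

end HasConfPB

/-- The rotation generated by `L'ᵢ`: the vector with components `Σₕ ε_{ijh} α² wₕ`. -/
def levicivitaRot (α : ℝ) (i : Fin 3) (w : Fin 3 → ℝ) (j : Fin 3) : ℝ :=
  ∑ h : Fin 3, levicivita i j h * α ^ 2 * w h

theorem pdp_neg_Lconf (α : ℝ) (i j : Fin 3) {q p : Fin 3 → ℝ} (hp : ∀ j, p j ≠ 0) :
    pdp (fun q p => -Lconf α i q p) j q p =
      α * |p j| ^ (α - 1) * levicivitaRot α i (fun h => confPow α (q h)) j := by
  have hd := hasDerivAt_confPow_update α hp j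
  have h : pdp (fun q p => -Lconf α i q p) j q p = _ :=
    ((((hd (i + 2)).const_mul (confPow α (q (i + 1)))).sub
      ((hd (i + 1)).const_mul (confPow α (q (i + 2))))).const_mul (α ^ 2)).neg.deriv
  rw [h]
  fin_cases i <;> fin_cases j <;>
    simp [levicivitaRot, levicivita, Fin.sum_univ_three] <;> ring

theorem pdq_neg_Lconf (α : ℝ) (i j : Fin 3) {q p : Fin 3 → ℝ} (hq : ∀ j, q j ≠ 0) :
    pdq (fun q p => -Lconf α i q p) j q p =
      -(α * |q j| ^ (α - 1) * levicivitaRot α i (fun h => confPow α (p h)) j) := by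
  have hd := hasDerivAt_confPow_update α hq j
  have h : pdq (fun q p => -Lconf α i q p) j q p = _ :=
    ((((hd (i + 1)).mul_const (confPow α (p (i + 2)))).sub
      ((hd (i + 2)).mul_const (confPow α (p (i + 1))))).const_mul (α ^ 2)).neg.deriv
  rw [h]
  fin_cases i <;> fin_cases j <;>
    simp [levicivitaRot, levicivita, Fin.sum_univ_three] <;> ring

section Rotation

variable {α m k : ℝ} {i : Fin 3} {q p : Fin 3 → ℝ}

theorem hasConfPB_neg_Lconf_confPow_q (hα : α ≠ 0) (hq : ∀ j, q j ≠ 0) (hp : ∀ j, p j ≠ 0)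
    (j : Fin 3) :
    HasConfPB α (fun q p => -Lconf α i q p) (fun q _ => confPow α (q j))
      (levicivitaRot α i (fun h => confPow α (q h)) j) q p := by
  refine (HasConfPB.confPow_q hq j).congr_value ?_
  rw [pdp_neg_Lconf α i j hp]
  have h := abs_rpow_mul_abs_rpow α (hp j)
  field_simp
  linear_combination levicivitaRot α i (fun h => confPow α (q h)) j * h

theorem hasConfPB_neg_Lconf_confPow_p (hα : α ≠ 0) (hq : ∀ j, q j ≠ 0) (hp : ∀ j, p j ≠ 0)
    (j : Fin 3) :
    HasConfPB α (fun q p => -Lconf α i q p) (fun _ p => confPow α (p j))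
      (levicivitaRot α i (fun h => confPow α (p h)) j) q p := by
  refine (HasConfPB.confPow_p hp j).congr_value ?_
  rw [pdq_neg_Lconf α i j hq]
  have h := abs_rpow_mul_abs_rpow α (hq j)
  field_simp
  linear_combination levicivitaRot α i (fun h => confPow α (p h)) j * h

theorem rConf_radicand_pos (hα : α ≠ 0) (hq : ∀ j, q j ≠ 0) :
    0 < ∑ i : Fin 3, (α * confPow α (q i)) ^ 2 :=
  Finset.sum_pos (fun j _ => sq_pos_of_ne_zero (mul_ne_zero hα (confPow_ne_zero α (hq j))))
    Finset.univ_nonempty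

theorem hasConfPB_neg_Lconf_inv_rConf (hα : α ≠ 0) (hq : ∀ j, q j ≠ 0) (hp : ∀ j, p j ≠ 0) :
    HasConfPB α (fun q p => -Lconf α i q p) (fun q _ => (rConf α q)⁻¹) 0 q p := by
  have hX j := hasConfPB_neg_Lconf_confPow_q (i := i) hα hq hp j
  have hS : HasConfPB α (fun q p => -Lconf α i q p)
      (fun q _ => ∑ i : Fin 3, (α * confPow α (q i)) ^ 2) 0 q p := by
    simp only [Fin.sum_univ_three]
    refine (((((hX 0).const_mul α).pow_two).add (((hX 1).const_mul α).pow_two)).add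
      (((hX 2).const_mul α).pow_two)).congr_value ?_
    fin_cases i <;> simp [levicivitaRot, levicivita, Fin.sum_univ_three] <;> ring
  have hpos := rConf_radicand_pos hα hq
  exact ((hS.sqrt hpos.ne').inv (Real.sqrt_pos.mpr hpos).ne').congr_value (by ring)

theorem hasConfPB_neg_Lconf_Hconf (hα : α ≠ 0) (hq : ∀ j, q j ≠ 0) (hp : ∀ j, p j ≠ 0) :
    HasConfPB α (fun q p => -Lconf α i q p) (Hconf α m k) 0 q p := by
  have hY j := hasConfPB_neg_Lconf_confPow_p (i := i) hα hq hp j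
  have hr := hasConfPB_neg_Lconf_inv_rConf (i := i) hα hq hp
  have h := (((((((hY 0).const_mul α).pow_two).add (((hY 1).const_mul α).pow_two)).add
      (((hY 2).const_mul α).pow_two)).const_mul (2 * m)⁻¹).sub (hr.const_mul k)).congr_value
      (v₂ := 0) (by
        fin_cases i <;> simp [levicivitaRot, levicivita, Fin.sum_univ_three, -mul_eq_zero] <;>
          ring)
  convert h using 3 with q p
  simp only [Hconf, Fin.sum_univ_three]
  ring

theorem hasConfPB_neg_Lconf_Aconf (hα : α ≠ 0) (hq : ∀ j, q j ≠ 0) (hp : ∀ j, p j ≠ 0)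
    (j : Fin 3) :
    HasConfPB α (fun q p => -Lconf α i q p) (Aconf α m k j)
      (levicivitaRot α i (fun h => Aconf α m k h q p) j) q p := by
  have hX j := hasConfPB_neg_Lconf_confPow_q (i := i) hα hq hp j
  have hY j := hasConfPB_neg_Lconf_confPow_p (i := i) hα hq hp j
  have hr := hasConfPB_neg_Lconf_inv_rConf (i := i) hα hq hp
  have hL j : HasConfPB α (fun q p => -Lconf α i q p) (Lconf α j) _ q p :=
    (((hX (j + 1)).mul (hY (j + 2))).sub ((hX (j + 2)).mul (hY (j + 1)))).const_mul (α ^ 2)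
  have h := ((((hY (j + 1)).mul (hL (j + 2))).sub ((hY (j + 2)).mul (hL (j + 1)))).const_mul
    α).sub ((hr.const_mul (α * m * k)).mul (hX j))
  simp only [← div_eq_mul_inv] at h
  refine HasConfPB.congr_value (g := Aconf α m k j) h ?_
  fin_cases i <;> fin_cases j <;>
    simp [levicivitaRot, levicivita, Fin.sum_univ_three, Aconf, Lconf, -mul_eq_zero] <;> ring

theorem hasConfPB_neg_Lconf_GammaNeg (hα : α ≠ 0) (hm : 0 < m) (hq : ∀ j, q j ≠ 0)
    (hp : ∀ j, p j ≠ 0) (hH : Hconf α m k q p < 0) (j : Fin 3) :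
    HasConfPB α (fun q p => -Lconf α i q p) (GammaNeg α m k j)
      (levicivitaRot α i (fun h => GammaNeg α m k h q p) j) q p := by
  have hpos : 0 < -(2 * m * Hconf α m k q p) := by nlinarith
  have hs := (((hasConfPB_neg_Lconf_Hconf (m := m) (k := k) (i := i) hα hq hp).const_mul
    (2 * m)).neg.sqrt hpos.ne').inv (Real.sqrt_pos.mpr hpos).ne'
  have h := (hasConfPB_neg_Lconf_Aconf (m := m) (k := k) (i := i) hα hq hp j).neg.mul hs
  simp only [← div_eq_mul_inv] at h
  refine HasConfPB.congr_value (g := GammaNeg α m k j) h ?_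
  simp only [levicivitaRot, GammaNeg, Fin.sum_univ_three]
  ring

end Rotation

/-- on the negative-energy region the functions `L′ᵅᵢ = -Lᵅᵢ` and
`Γⱼ = -Aᵅⱼ/√(-2mH_α)` satisfy the mixed `so(4)` relations
`{L′ᵅᵢ, Γⱼ}_α = Σₕ ε_{ijh} α² Γₕ`. -/
theorem confPB_Lconf_GammaNeg_so4
    (α m k : ℝ) (hα : 1 ≤ α) (hm : 0 < m)
    (q p : Fin 3 → ℝ) (hq : ∀ j, q j ≠ 0) (hp : ∀ j, p j ≠ 0)
    (hH : Hconf α m k q p < 0) (i j : Fin 3) :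
    confPB α (fun q p => -Lconf α i q p) (GammaNeg α m k j) q p
      = ∑ h : Fin 3, levicivita i j h * α ^ 2 * GammaNeg α m k h q p :=
  (hasConfPB_neg_Lconf_GammaNeg (zero_lt_one.trans_le hα).ne' hm hq hp hH j).confPB_eq
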